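/- arXiv:1905.12461 — 3 statements merged into one kernel-verified Lean document; each statement's English description precedes it below -/
import Mathlib

section
/- Let (G, A, B) be a splitted graph and H a finite simple graph with vertex set disjoint from that of G. Then cw((G, A, B) ∘ H) ≤ max{3, scw(G, A, B), cw(H)}. -/
namespace CWPaper

/-! ## Clique-width expressions -/

/-- Syntax of clique-width expressions.  Labels are natural numbers (`0`-indexed, so a
`k`-expression uses labels `0, …, k-1`). -/
inductive Expr : Type
  | vert : ℕ → Expr
  | union : Expr → Expr → Expr
  | join : ℕ → ℕ → Expr → Expr
  | relabel : ℕ → ℕ → Expr → Expr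

namespace Expr

/-- The vertex set of an expression: one vertex per `vert` leaf. -/
def Verts : Expr → Type
  | vert _ => Unit
  | union a b => Verts a ⊕ Verts b
  | join _ _ a => Verts a
  | relabel _ _ a => Verts a

/-- The label of each vertex after evaluating the expression. -/
def label : (e : Expr) → e.Verts → ℕ
  | vert i, _ => i
  | union a b, v => Sum.elim a.label b.label v
  | join _ _ a, v => a.label v
  | relabel i j a, v => if a.label v = i then j else a.label v

/-- The adjacency relation of the labeled graph built by the expression. -/
def adj : (e : Expr) → e.Verts → e.Verts → Prop
  | vert _, _, _ => False
  | union a b, u, v =>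
      match u, v with
      | .inl u, .inl v => a.adj u v
      | .inr u, .inr v => b.adj u v
      | _, _ => False
  | join i j a, u, v =>
      a.adj u v ∨ (a.label u = i ∧ a.label v = j) ∨ (a.label u = j ∧ a.label v = i)
  | relabel _ _ a, u, v => a.adj u v

/-- `e` is a `k`-expression: all labels used are among `0, …, k-1`, and joins use two
distinct labels. -/
def Valid (k : ℕ) : Expr → Prop
  | vert i => i < k
  | union a b => Valid k a ∧ Valid k b
  | join i j a => i < k ∧ j < k ∧ i ≠ j ∧ Valid k a
  | relabel i j a => i < k ∧ j < k ∧ Valid k a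

/-- The expression `e` constructs the simple graph `G` (the final labels are ignored). -/
def Constructs (e : Expr) {V : Type*} (G : SimpleGraph V) : Prop :=
  ∃ f : e.Verts ≃ V, ∀ u v, G.Adj (f u) (f v) ↔ e.adj u v

/-- The expression `e` constructs the graph `G` *split labeled* with respect to `(A, B)`:
every vertex of `A` ends with the first label (encoded `0`) and every vertex of `B` ends
with the second label (encoded `1`). -/
def ConstructsSplit (e : Expr) {V : Type*} (G : SimpleGraph V) (A B : Set V) : Prop :=
  ∃ f : e.Verts ≃ V, (∀ u v, G.Adj (f u) (f v) ↔ e.adj u v) ∧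
    ∀ u, (f u ∈ A → e.label u = 0) ∧ (f u ∈ B → e.label u = 1)

end Expr

/-- The clique-width of a graph: the least `k` such that some `k`-expression constructs it. -/
noncomputable def cliqueWidth {V : Type*} (G : SimpleGraph V) : ℕ :=
  sInf {k | ∃ e : Expr, e.Valid k ∧ e.Constructs G}

/-- The split clique-width of a splitted graph `(G, A, B)`: the least `k` such that some
`k`-expression constructs `G` split labeled. -/
noncomputable def splitCliqueWidth {V : Type*} (G : SimpleGraph V) (A B : Set V) : ℕ :=
  sInf {k | ∃ e : Expr, e.Valid k ∧ e.ConstructsSplit G A B}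

/-! ## Splitted graphs and compositions -/

/-- `(G, A, B)` is a splitted graph: `A` and `B` partition the vertex set, `A` is a clique
and `B` is an independent set. -/
def IsSplitted {V : Type*} (G : SimpleGraph V) (A B : Set V) : Prop :=
  A ∪ B = Set.univ ∧ Disjoint A B ∧
    (∀ a ∈ A, ∀ b ∈ A, a ≠ b → G.Adj a b) ∧ (∀ a ∈ B, ∀ b ∈ B, ¬ G.Adj a b)

/-- The composition `(G, A, B) ∘ H` of a splitted graph with a graph `H` on a disjoint
vertex set: take the disjoint union and add all edges between `A` and `V(H)`. -/
def comp {U W : Type*} (G : SimpleGraph U) (A : Set U) (H : SimpleGraph W) :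
    SimpleGraph (U ⊕ W) :=
  SimpleGraph.fromRel fun x y =>
    match x, y with
    | .inl a, .inl b => G.Adj a b
    | .inr a, .inr b => H.Adj a b
    | .inl a, .inr _ => a ∈ A
    | .inr _, .inl _ => False

/-- Inverting a splitted graph `(G, A, B)`: remove all edges inside `A` and add all edges
inside `B`.  The inverse splitted graph is `(splitInverse G A B, B, A)`. -/
def splitInverse {V : Type*} (G : SimpleGraph V) (A B : Set V) : SimpleGraph V :=
  SimpleGraph.fromRel fun x y =>
    (G.Adj x y ∧ ¬(x ∈ A ∧ y ∈ A)) ∨ (x ∈ B ∧ y ∈ B)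

/-! ## Unigraphs -/

/-- The multiset of vertex degrees of a finite graph. -/
noncomputable def degreeMultiset (V : Type*) [Fintype V] (G : SimpleGraph V) : Multiset ℕ :=
  (Finset.univ.val : Multiset V).map fun v => (G.neighborSet v).ncard

/-- A finite graph is a unigraph if every finite graph with the same degree multiset is
isomorphic to it. -/
def IsUnigraph {V : Type u} [Fintype V] (G : SimpleGraph V) : Prop :=
  ∀ (W : Type u) (_ : Fintype W) (H : SimpleGraph W),
    degreeMultiset W H = degreeMultiset V G → Nonempty (G ≃g H)

/-! ## Concrete graphs -/

/-- `mK2 m` : the disjoint union of `m` copies of `K₂`. -/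
def mK2 (m : ℕ) : SimpleGraph (Fin m × Fin 2) :=
  SimpleGraph.fromRel fun x y => x.1 = y.1

/-- The star `K_{1,s}`; `none` is the center and the `some i` are the leaves. -/
def starG (s : ℕ) : SimpleGraph (Option (Fin s)) :=
  SimpleGraph.fromRel fun x _ => x = none

/-- `U2 m s` : the disjoint union of `mK₂` and the star `K_{1,s}`. -/
def U2 (m s : ℕ) : SimpleGraph ((Fin m × Fin 2) ⊕ Option (Fin s)) :=
  SimpleGraph.fromRel fun x y =>
    match x, y with
    | .inl a, .inl b => a.1 = b.1
    | .inr a, .inr _ => a = none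
    | _, _ => False

/-- `U3 m` : the disjoint union of `C₄` and `m` triangles with one vertex of each
component identified into the hub `none`.  The vertices `some (Sum.inl i)`, `i = 0, 1, 2`,
are the remaining path of the `C₄` (so the hub is joined to its two endpoints), and
`some (Sum.inr (i, x))` are the two remaining vertices of the `i`-th triangle. -/
def U3 (m : ℕ) : SimpleGraph (Option (Fin 3 ⊕ Fin m × Fin 2)) :=
  SimpleGraph.fromRel fun x y =>
    match x, y with
    | none, some (.inl i) => i ≠ 1
    | none, some (.inr _) => True
    | some (.inl i), some (.inl j) => (i : ℕ) + 1 = (j : ℕ)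
    | some (.inr a), some (.inr b) => a.1 = b.1
    | _, _ => False

/-- A graph is `P₄`-free if no four vertices induce a path on four vertices. -/
def P4Free {V : Type*} (G : SimpleGraph V) : Prop :=
  IsEmpty (SimpleGraph.pathGraph 4 ↪g G)

/-! ## The split unigraphs `S₂`, `S₃`, `S₄` -/

/-- Vertices of `S₂`: the centers `Sum.inl ⟨i, j⟩` (`j`-th center of multiplicity block `i`)
and the leaves `Sum.inr ⟨i, j, x⟩` (`x`-th leaf of the star with center `⟨i, j⟩`). -/
def S2Verts (t : ℕ) (p q : Fin t → ℕ) : Type :=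
  (Σ i : Fin t, Fin (q i)) ⊕ (Σ i : Fin t, Fin (q i) × Fin (p i))

/-- The center of the star a leaf belongs to. -/
def leafCenter {t : ℕ} {p q : Fin t → ℕ} (e : Σ i : Fin t, Fin (q i) × Fin (p i)) :
    Σ i : Fin t, Fin (q i) :=
  ⟨e.1, e.2.1⟩

/-- The split graph `S₂(p₁, q₁; …; p_t, q_t)`: for each `i`, take `q i` disjoint stars
`K_{1, p i}` and join every two centers.  The clique is the set of centers
(`Set.range Sum.inl`) and the independent set is the set of leaves (`Set.range Sum.inr`). -/
def S2 (t : ℕ) (p q : Fin t → ℕ) : SimpleGraph (S2Verts t p q) :=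
  SimpleGraph.fromRel fun x y =>
    match x, y with
    | .inl _, .inl _ => True
    | .inl c, .inr e => leafCenter e = c
    | _, _ => False

/-- The split graph `S₃(p, q₁; q₂)`: add to `S₂(p, q₁; p+1, q₂)` a new independent vertex
`none` joined to exactly the `q₁` centers of the stars `K_{1,p}`. -/
def S3 (p q1 q2 : ℕ) : SimpleGraph (Option (S2Verts 2 ![p, p + 1] ![q1, q2])) :=
  SimpleGraph.fromRel fun x y =>
    match x, y with
    | some a, some b => (S2 2 ![p, p + 1] ![q1, q2]).Adj a b
    | none, some (.inl c) => c.1 = 0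
    | _, _ => False

/-- The clique of the splitted graph `S₃(p, q₁; q₂)` (the star centers). -/
def S3A (p q1 q2 : ℕ) : Set (Option (S2Verts 2 ![p, p + 1] ![q1, q2])) :=
  {x | ∃ c, x = some (Sum.inl c)}

/-- The independent set of the splitted graph `S₃(p, q₁; q₂)` (the leaves and the extra
vertex `none`). -/
def S3B (p q1 q2 : ℕ) : Set (Option (S2Verts 2 ![p, p + 1] ![q1, q2])) :=
  {x | x = none ∨ ∃ e, x = some (Sum.inr e)}

/-- The split graph `S₄(p, q)`: add to `S₃(p, 2; q)` a new clique vertex (the outer `none`)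
joined to every vertex except itself and the special vertex `v` of `S₃` (here `some none`). -/
def S4 (p q : ℕ) : SimpleGraph (Option (Option (S2Verts 2 ![p, p + 1] ![2, q]))) :=
  SimpleGraph.fromRel fun x y =>
    match x, y with
    | some a, some b => (S3 p 2 q).Adj a b
    | none, some (some _) => True
    | _, _ => False

/-- The clique of the splitted graph `S₄(p, q)` (the star centers and the new vertex `u`). -/
def S4A (p q : ℕ) : Set (Option (Option (S2Verts 2 ![p, p + 1] ![2, q]))) :=
  {x | x = none ∨ ∃ c, x = some (some (Sum.inl c))}

/-- The independent set of the splitted graph `S₄(p, q)` (the leaves and the vertex `v`). -/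
def S4B (p q : ℕ) : Set (Option (Option (S2Verts 2 ![p, p + 1] ![2, q]))) :=
  {x | x = some none ∨ ∃ e, x = some (some (Sum.inr e))}

namespace Expr

theorem Valid.mono {k m : ℕ} (hkm : k ≤ m) : ∀ {e : Expr}, e.Valid k → e.Valid m
  | vert _, h => lt_of_lt_of_le h hkm
  | union _ _, h => ⟨Valid.mono hkm h.1, Valid.mono hkm h.2⟩
  | join _ _ _, h => ⟨h.1.trans_le hkm, h.2.1.trans_le hkm, h.2.2.1, Valid.mono hkm h.2.2.2⟩
  | relabel _ _ _, h => ⟨h.1.trans_le hkm, h.2.1.trans_le hkm, Valid.mono hkm h.2.2⟩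

theorem Valid.label_lt {k : ℕ} : ∀ {e : Expr}, e.Valid k → ∀ u, e.label u < k
  | vert _, h, _ => h
  | union _ _, h, .inl u => Valid.label_lt h.1 u
  | union _ _, h, .inr u => Valid.label_lt h.2 u
  | join _ _ _, h, u => Valid.label_lt h.2.2.2 u
  | relabel i j a, h, u => by
      change (if a.label u = i then j else a.label u) < k
      split_ifs
      · exact h.2.1
      · exact Valid.label_lt h.2.2 u

theorem verts_finite : ∀ e : Expr, Finite e.Verts
  | vert _ => inferInstanceAs (Finite Unit)
  | union a b =>
      have := verts_finite a
      have := verts_finite b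
      inferInstanceAs (Finite (a.Verts ⊕ b.Verts))
  | join _ _ a => verts_finite a
  | relabel _ _ a => verts_finite a

theorem verts_nonempty : ∀ e : Expr, Nonempty e.Verts
  | vert _ => ⟨()⟩
  | union a _ => (verts_nonempty a).map Sum.inl
  | join _ _ a => verts_nonempty a
  | relabel _ _ a => verts_nonempty a

end Expr

/-- Some `k`-expression builds the relation `R` on `V` with final labeling `l`. -/
def Realizes (k : ℕ) {V : Type*} (R : V → V → Prop) (l : V → ℕ) : Prop :=
  ∃ e : Expr, e.Valid k ∧ ∃ f : e.Verts ≃ V,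
    (∀ u v, R (f u) (f v) ↔ e.adj u v) ∧ ∀ u, l (f u) = e.label u

namespace Realizes

variable {k m : ℕ} {V V' : Type*} {R : V → V → Prop} {l : V → ℕ}
  {R' : V' → V' → Prop} {l' : V' → ℕ}

theorem mono (h : Realizes k R l) (hkm : k ≤ m) : Realizes m R l := by
  obtain ⟨e, he, hf⟩ := h
  exact ⟨e, he.mono hkm, hf⟩

theorem label_lt (h : Realizes k R l) (v : V) : l v < k := by
  obtain ⟨e, he, f, -, hl⟩ := h
  have := hl (f.symm v)
  rw [f.apply_symm_apply] at this
  exact this ▸ he.label_lt _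

theorem congr (h : Realizes k R l) (σ : V ≃ V') (hR : ∀ u v, R' (σ u) (σ v) ↔ R u v)
    (hl : ∀ u, l' (σ u) = l u) : Realizes k R' l' := by
  obtain ⟨e, he, f, hadj, hlab⟩ := h
  exact ⟨e, he, f.trans σ, fun u v => (hR _ _).trans (hadj u v),
    fun u => (hl _).trans (hlab u)⟩

theorem of_iff (h : Realizes k R l) {S : V → V → Prop} {c : V → ℕ}
    (hR : ∀ u v, S u v ↔ R u v) (hl : ∀ u, c u = l u) : Realizes k S c :=
  h.congr (Equiv.refl V) hR hl

theorem union (h : Realizes k R l) (h' : Realizes k R' l') :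
    Realizes k (Sum.LiftRel R R') (Sum.elim l l') := by
  obtain ⟨e, he, f, hadj, hlab⟩ := h
  obtain ⟨e', he', f', hadj', hlab'⟩ := h'
  refine ⟨.union e e', ⟨he, he'⟩, Equiv.sumCongr f f', ?_, ?_⟩
  · rintro (u | u) (v | v)
    · exact Sum.liftRel_inl_inl.trans (hadj u v)
    · exact iff_of_false Sum.not_liftRel_inl_inr id
    · exact iff_of_false Sum.not_liftRel_inr_inl id
    · exact Sum.liftRel_inr_inr.trans (hadj' u v)
  · rintro (u | u)
    · exact hlab u
    · exact hlab' u

theorem join (h : Realizes k R l) {i j : ℕ} (hi : i < k) (hj : j < k) (hij : i ≠ j) :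
    Realizes k (fun u v => R u v ∨ (l u = i ∧ l v = j) ∨ (l u = j ∧ l v = i)) l := by
  obtain ⟨e, he, f, hadj, hlab⟩ := h
  have hjoin : ∀ u v : e.Verts,
      (R (f u) (f v) ∨ (l (f u) = i ∧ l (f v) = j) ∨ (l (f u) = j ∧ l (f v) = i)) ↔
        (e.adj u v ∨ (e.label u = i ∧ e.label v = j) ∨ (e.label u = j ∧ e.label v = i)) :=
    fun u v => by rw [hadj, hlab, hlab]
  exact ⟨.join i j e, ⟨hi, hj, hij, he⟩, f, hjoin, hlab⟩

theorem relabel (h : Realizes k R l) {i j : ℕ} (hi : i < k) (hj : j < k) :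
    Realizes k R (fun u => if l u = i then j else l u) := by
  obtain ⟨e, he, f, hadj, hlab⟩ := h
  have hrelabel : ∀ u : e.Verts, (if l (f u) = i then j else l (f u)) =
      if e.label u = i then j else e.label u := fun u => by rw [hlab]
  exact ⟨.relabel i j e, ⟨hi, hj, he⟩, f, hadj, hrelabel⟩

theorem relabel_const (h : Realizes k R l) {j : ℕ} (hj : j < k) :
    Realizes k R (fun _ => j) := by
  suffices ∀ n ≤ k, Realizes k R (fun u => if l u < n then j else l u) from
    (this k le_rfl).of_iff (fun _ _ => Iff.rfl) fun u => by simp [h.label_lt u]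
  intro n hn
  induction n with
  | zero => simpa using h
  | succ n ih =>
    refine ((ih (by omega)).relabel (i := n) (by omega) hj).of_iff (fun _ _ => Iff.rfl) ?_
    intro u
    grind

theorem empty_fin (n : ℕ) (l : Fin (n + 1) → ℕ) (hl : ∀ u, l u < k) :
    Realizes k (fun _ _ : Fin (n + 1) => False) l := by
  induction n with
  | zero =>
    refine ⟨.vert (l 0), hl 0, (Equiv.ofUnique Unit (Fin 1) : Unit ≃ Fin 1),
      fun _ _ => Iff.rfl, fun u => ?_⟩
    exact congrArg l (Subsingleton.elim (α := Fin 1) _ _)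
  | succ n ih =>
    have hv : Realizes k (fun _ _ : Unit => False) (fun _ => l 0) :=
      ⟨.vert (l 0), hl 0, Equiv.refl Unit, fun _ _ => Iff.rfl, fun _ => rfl⟩
    refine ((ih (fun i => l i.succ) fun u => hl _).union hv).congr
      ((Equiv.optionEquivSumPUnit _).symm.trans (finSuccEquiv (n + 1)).symm) ?_ ?_
    · rintro (u | u) (v | v) <;> simp
    · rintro (u | u) <;> simp

theorem empty [Finite V] [Nonempty V] (hl : ∀ u, l u < k) :
    Realizes k (fun _ _ : V => False) l := by
  obtain ⟨n, ⟨σ⟩⟩ := Finite.exists_equiv_fin V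
  cases n with
  | zero => exact (σ (Classical.arbitrary V)).elim0
  | succ n =>
    exact (empty_fin n (fun i => l (σ.symm i)) fun _ => hl _).congr σ.symm
      (fun _ _ => Iff.rfl) fun _ => rfl

theorem of_injective [Finite V] [Nonempty V] (G : SimpleGraph V)
    (hl : ∀ u, l u < k) (hinj : Function.Injective l) : Realizes k G.Adj l := by
  classical
  have := Fintype.ofFinite V
  suffices ∀ s : Finset (V × V),
      Realizes k (fun u v => G.Adj u v ∧ ((u, v) ∈ s ∨ (v, u) ∈ s)) l from
    (this Finset.univ).of_iff (fun _ _ => by simp) fun _ => rfl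
  intro s
  induction s using Finset.induction_on with
  | empty => simpa using empty hl
  | insert p s _ ih =>
    obtain ⟨a, b⟩ := p
    by_cases hab : G.Adj a b
    · refine (ih.join (hl a) (hl b) (hinj.ne hab.ne)).of_iff (fun u v => ?_) fun _ => rfl
      have := hab.symm
      simp only [hinj.eq_iff, Finset.mem_insert, Prod.mk.injEq]
      grind
    · refine ih.of_iff (fun u v => ?_) fun _ => rfl
      have : ¬ G.Adj b a := fun h => hab h.symm
      simp only [Finset.mem_insert, Prod.mk.injEq]
      grind

theorem relabel_of_injective [Finite V] (h : Realizes k R l) (hinj : Function.Injective l)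
    {c : V → ℕ} (hc : ∀ u, c u < k) (hcl : ∀ u v, c u ≠ l v) : Realizes k R c := by
  classical
  have := Fintype.ofFinite V
  suffices ∀ s : Finset V, Realizes k R (fun u => if u ∈ s then c u else l u) from
    (this Finset.univ).of_iff (fun _ _ => Iff.rfl) fun _ => by simp
  intro s
  induction s using Finset.induction_on with
  | empty => simpa using h
  | insert a s ha ih =>
    refine (ih.relabel (h.label_lt a) (hc a)).of_iff (fun _ _ => Iff.rfl) fun u => ?_
    have := hcl u a
    have := hinj.eq_iff (a := u) (b := a)
    grind

/-- Every finite nonempty graph is built, with any prescribed labeling, by some expression. -/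
theorem exists_of_finite [Finite V] [Nonempty V] (G : SimpleGraph V) (c : V → ℕ) :
    ∃ k, Realizes k G.Adj c := by
  obtain ⟨n, ⟨σ⟩⟩ := Finite.exists_equiv_fin V
  obtain ⟨N, hN⟩ := (Set.finite_range c).bddAbove
  have hc : ∀ u, c u ≤ N := fun u => hN ⟨u, rfl⟩
  have hinj : Function.Injective fun u => N + 1 + (σ u : ℕ) := fun u v huv =>
    σ.injective (Fin.ext (Nat.add_left_cancel huv))
  refine ⟨N + 1 + n, (of_injective G (fun u => ?_) hinj).relabel_of_injective hinj ?_ ?_⟩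
  · have := (σ u).isLt
    omega
  · intro u
    have := hc u
    omega
  · intro u v
    have := hc u
    omega

theorem cliqueWidth_le {G : SimpleGraph V} (h : Realizes k G.Adj l) : cliqueWidth G ≤ k := by
  obtain ⟨e, he, f, hadj, -⟩ := h
  exact Nat.sInf_le ⟨e, he, f, hadj⟩

end Realizes

theorem exists_realizes_cliqueWidth {V : Type*} [Finite V] [Nonempty V] (G : SimpleGraph V) :
    ∃ l, Realizes (cliqueWidth G) G.Adj l := by
  obtain ⟨k, e, he, f, hadj, -⟩ := Realizes.exists_of_finite G fun _ => 0
  obtain ⟨e, he, f, hadj⟩ := Nat.sInf_mem (s := {k | ∃ e : Expr, e.Valid k ∧ e.Constructs G})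
    ⟨k, e, he, f, hadj⟩
  exact ⟨fun v => e.label (f.symm v), e, he, f, hadj, fun u => by simp⟩

theorem exists_realizes_splitCliqueWidth {V : Type*} [Finite V] [Nonempty V]
    {G : SimpleGraph V} {A B : Set V} (h : IsSplitted G A B) :
    ∃ l : V → ℕ, (∀ v ∈ A, l v = 0) ∧ (∀ v ∉ A, l v = 1) ∧
      Realizes (splitCliqueWidth G A B) G.Adj l := by
  classical
  obtain ⟨hun, hdisj, -, -⟩ := h
  obtain ⟨k, e, he, f, hadj, hl⟩ :=
    Realizes.exists_of_finite G fun v => if v ∈ A then 0 else 1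
  obtain ⟨e, he, f, hadj, hlab⟩ :=
    Nat.sInf_mem (s := {k | ∃ e : Expr, e.Valid k ∧ e.ConstructsSplit G A B})
      ⟨k, e, he, f, hadj, fun u => ⟨fun hu => (hl u).symm.trans (if_pos hu),
        fun hu => (hl u).symm.trans (if_neg (Set.disjoint_right.mp hdisj hu))⟩⟩
  refine ⟨fun v => e.label (f.symm v), fun v hv => (hlab _).1 (by simpa using hv),
    fun v hv => (hlab _).2 ?_, e, he, f, hadj, fun u => by simp⟩
  rw [f.apply_symm_apply]
  exact (hun.symm ▸ Set.mem_univ v : v ∈ A ∪ B).resolve_left hv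

section Comp

variable {U W : Type*} (G : SimpleGraph U) (A : Set U) (H : SimpleGraph W)

@[simp] theorem comp_adj_inl_inl (a b : U) :
    (comp G A H).Adj (.inl a) (.inl b) ↔ G.Adj a b := by
  simp only [comp, SimpleGraph.fromRel_adj, ne_eq, Sum.inl.injEq, G.adj_comm b a, or_self]
  exact ⟨And.right, fun h => ⟨h.ne, h⟩⟩

@[simp] theorem comp_adj_inr_inr (a b : W) :
    (comp G A H).Adj (.inr a) (.inr b) ↔ H.Adj a b := by
  simp only [comp, SimpleGraph.fromRel_adj, ne_eq, Sum.inr.injEq, H.adj_comm b a, or_self]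
  exact ⟨And.right, fun h => ⟨h.ne, h⟩⟩

@[simp] theorem comp_adj_inl_inr (a : U) (b : W) :
    (comp G A H).Adj (.inl a) (.inr b) ↔ a ∈ A := by
  simp [comp]

@[simp] theorem comp_adj_inr_inl (a : U) (b : W) :
    (comp G A H).Adj (.inr b) (.inl a) ↔ a ∈ A := by
  simp [comp]

end Comp

theorem stmt3 {U W : Type} (G : SimpleGraph U) (A B : Set U) (H : SimpleGraph W)
    (h : IsSplitted G A B) :
    cliqueWidth (comp G A H) ≤ max 3 (max (splitCliqueWidth G A B) (cliqueWidth H)) := by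
  rcases Set.eq_empty_or_nonempty
    {k | ∃ e : Expr, e.Valid k ∧ e.Constructs (comp G A H)} with hempty | ⟨_, e, -, f, -⟩
  · simp [cliqueWidth, hempty]
  have : Finite (U ⊕ W) := have := e.verts_finite; Finite.of_equiv _ f
  have : Finite U := Finite.of_injective (Sum.inl : U → U ⊕ W) Sum.inl_injective
  have : Finite W := Finite.of_injective (Sum.inr : W → U ⊕ W) Sum.inr_injective
  rcases isEmpty_or_nonempty U with hU | hU <;> rcases isEmpty_or_nonempty W with hW | hW
  · exact isEmptyElim (f e.verts_nonempty.some)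
  · obtain ⟨l, hl⟩ := exists_realizes_cliqueWidth H
    refine (Realizes.cliqueWidth_le (l := Sum.elim (fun _ => 0) l) (hl.congr
      (Equiv.emptySum U W).symm (fun u v => ?_) fun u => ?_)).trans
      ((le_max_right _ _).trans (le_max_right _ _)) <;> simp
  · obtain ⟨l, -, -, hl⟩ := exists_realizes_splitCliqueWidth h
    refine (Realizes.cliqueWidth_le (l := Sum.elim l (fun _ => 0)) (hl.congr
      (Equiv.sumEmpty U W).symm (fun u v => ?_) fun u => ?_)).trans
      ((le_max_left _ _).trans (le_max_right _ _)) <;> simp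
  · obtain ⟨l, hA, hB, hl⟩ := exists_realizes_splitCliqueWidth h
    obtain ⟨l', hl'⟩ := exists_realizes_cliqueWidth H
    set k := max 3 (max (splitCliqueWidth G A B) (cliqueWidth H)) with hk
    have hk3 : 3 ≤ k := le_max_left _ _
    have hG : Realizes k G.Adj l := hl.mono ((le_max_left _ _).trans (le_max_right _ _))
    have hH : Realizes k H.Adj (fun _ => 2) :=
      (hl'.mono ((le_max_right _ _).trans (le_max_right _ _))).relabel_const (by omega)
    have hl0 : ∀ u, l u = 0 ↔ u ∈ A := fun u =>
      ⟨fun hu => by_contra fun hn => by simp [hB u hn] at hu, hA u⟩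
    have hl2 : ∀ u, l u ≠ 2 := fun u => by
      by_cases hu : u ∈ A
      · simp [hA u hu]
      · simp [hB u hu]
    refine (((hG.union hH).join (i := 0) (j := 2) (by omega) (by omega) (by omega)).of_iff
      ?_ fun _ => rfl).cliqueWidth_le
    rintro (u | u) (v | v) <;> simp [hl0, hl2]

end CWPaper
end

section
/- For all parameters p_1, q_1, …, p_t, q_t ≥ 1 with t ≥ 1 and q_1 + ⋯ + q_t ≥ 2, the split clique-width of the inverse of S_2(p_1, q_1; …; p_t, q_t) (the graph obtained by taking, for each i, the disjoint union of q_i stars K_{1,p_i} and adding an edge between every two leaves of the stars; its clique is the set of leaves and its independent set is the set of centers) is at most 3. -/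
namespace CWPaper

/-- The graph with adjacency relation `R` and labeling `lab` on `V` is built by some
`k`-expression. -/
def Buildable (k : ℕ) {V : Type} (R : V → V → Prop) (lab : V → ℕ) : Prop :=
  ∃ e : Expr, e.Valid k ∧ ∃ f : e.Verts ≃ V,
    (∀ u v, R (f u) (f v) ↔ e.adj u v) ∧ ∀ u, lab (f u) = e.label u

namespace Buildable

variable {k : ℕ} {V W : Type}

theorem vert {i : ℕ} (hi : i < k) [Unique V] :
    Buildable k (fun _ _ : V => False) (fun _ => i) :=
  ⟨.vert i, hi, (Equiv.ofUnique Unit V : Unit ≃ V), fun _ _ => Iff.rfl, fun _ => rfl⟩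

theorem union {R : V → V → Prop} {lab : V → ℕ} {S : W → W → Prop} {lab' : W → ℕ}
    (hR : Buildable k R lab) (hS : Buildable k S lab') :
    Buildable k (Sum.LiftRel R S) (Sum.elim lab lab') := by
  obtain ⟨a, ha, f, hf, hf'⟩ := hR
  obtain ⟨b, hb, g, hg, hg'⟩ := hS
  refine ⟨.union a b, ⟨ha, hb⟩, Equiv.sumCongr f g, ?_, ?_⟩
  · rintro (u | u) (v | v)
    · exact Sum.liftRel_inl_inl.trans (hf u v)
    · exact iff_of_false Sum.not_liftRel_inl_inr id
    · exact iff_of_false Sum.not_liftRel_inr_inl id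
    · exact Sum.liftRel_inr_inr.trans (hg u v)
  · rintro (u | u)
    · exact hf' u
    · exact hg' u

theorem join {R : V → V → Prop} {lab : V → ℕ} {i j : ℕ} (h : Buildable k R lab)
    (hi : i < k) (hj : j < k) (hij : i ≠ j) :
    Buildable k (fun u v => R u v ∨ (lab u = i ∧ lab v = j) ∨ (lab u = j ∧ lab v = i)) lab := by
  obtain ⟨a, ha, f, hf, hf'⟩ := h
  refine ⟨.join i j a, ⟨hi, hj, hij, ha⟩, f, fun (u v : a.Verts) => ?_, hf'⟩
  simp only [Expr.adj, ← hf, ← hf']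
  rfl

theorem relabel {R : V → V → Prop} {lab : V → ℕ} {i j : ℕ} (h : Buildable k R lab)
    (hi : i < k) (hj : j < k) :
    Buildable k R (fun v => if lab v = i then j else lab v) := by
  obtain ⟨a, ha, f, hf, hf'⟩ := h
  refine ⟨.relabel i j a, ⟨hi, hj, ha⟩, f, hf, fun (u : a.Verts) => ?_⟩
  simp only [Expr.label, ← hf']
  rfl

theorem of_equiv {R : V → V → Prop} {lab : V → ℕ} {S : W → W → Prop} {lab' : W → ℕ}
    (h : Buildable k R lab) (g : V ≃ W) (hS : ∀ u v, S (g u) (g v) ↔ R u v)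
    (hlab : ∀ u, lab' (g u) = lab u) : Buildable k S lab' := by
  obtain ⟨a, ha, f, hf, hf'⟩ := h
  exact ⟨a, ha, f.trans g, fun u v => (hS _ _).trans (hf u v), fun u => (hlab _).trans (hf' u)⟩

end Buildable

/-- The complete graph on a center `none`, labeled `1`, and leaves labeled `2`. -/
theorem buildable_pointedClique (L : Type) [Finite L] :
    Buildable 3 (fun x y : Option L => x ≠ y) (fun x => if x = none then 1 else 2) := by
  refine Finite.induction_empty_option (P := fun L : Type =>
    Buildable 3 (fun x y : Option L => x ≠ y) (fun x => if x = none then 1 else 2))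
    ?_ ?_ ?_ L
  · intro L M g h
    refine h.of_equiv (Equiv.optionCongr g) (fun u v => ?_) (fun u => ?_)
    · exact (Equiv.optionCongr g).injective.ne_iff
    · cases u <;> simp
  · refine (Buildable.vert (V := Option PEmpty) (i := 1) (by norm_num)).of_equiv
      (Equiv.refl _) ?_ ?_
    · rintro (_ | ⟨⟨⟩⟩) (_ | ⟨⟨⟩⟩); simp
    · rintro (_ | ⟨⟨⟩⟩); simp
  · intro L _ h
    refine ((((h.union (Buildable.vert (V := Unit) (i := 0) (by norm_num))).join
      (i := 0) (j := 1) (by norm_num) (by norm_num) (by norm_num)).join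
      (i := 0) (j := 2) (by norm_num) (by norm_num) (by norm_num)).relabel
      (i := 0) (j := 2) (by norm_num) (by norm_num)).of_equiv
      ((Equiv.optionEquivSumPUnit _).symm.trans
        { toFun := fun
            | none => some none
            | some none => none
            | some (some l) => some (some l)
          invFun := fun
            | none => some none
            | some none => none
            | some (some l) => some (some l)
          left_inv := by rintro (_ | _ | _) <;> rfl
          right_inv := by rintro (_ | _ | _) <;> rfl }) ?_ ?_
    · rintro ((_ | u) | u) ((_ | v) | v) <;> simp
    · rintro ((_ | u) | u) <;> simp

/-- Disjoint stars whose leaves, labeled `0`, form a clique, the centers being labeled `1`. -/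
theorem buildable_invertedStars (C : Type) [Finite C] [Nonempty C] (L : C → Type)
    [∀ c, Finite (L c)] :
    Buildable 3 (fun x y : Σ c, Option (L c) =>
        x ≠ y ∧ (x.1 = y.1 ∨ (x.2 ≠ none ∧ y.2 ≠ none)))
      (fun x => if x.2 = none then 1 else 0) := by
  refine Finite.induction_empty_option (P := fun C : Type =>
    Nonempty C → ∀ L : C → Type, (∀ c, Finite (L c)) →
    Buildable 3 (fun x y : Σ c, Option (L c) =>
        x ≠ y ∧ (x.1 = y.1 ∨ (x.2 ≠ none ∧ y.2 ≠ none)))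
      (fun x => if x.2 = none then 1 else 0)) ?_ ?_ ?_ C ‹_› L ‹_›
  · intro C D g h _ L hL
    refine (h (g.nonempty_congr.mpr ‹_›) (fun c => L (g c)) (fun _ => hL _)).of_equiv
      (Equiv.sigmaCongrLeft (β := fun d => Option (L d)) g) (fun u v => ?_) (fun u => rfl)
    rw [(Equiv.sigmaCongrLeft (β := fun d => Option (L d)) g).injective.ne_iff]
    simp [Equiv.sigmaCongrLeft]
  · rintro ⟨⟨⟩⟩
  · intro C _ h _ L hL
    have hnew := buildable_pointedClique (L none)
    rcases isEmpty_or_nonempty C with hC | hC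
    · refine (hnew.relabel (i := 2) (j := 0) (by norm_num) (by norm_num)).of_equiv
        (Equiv.uniqueSigma (fun c => Option (L c))).symm ?_ ?_
      · intro u v
        simp [Equiv.uniqueSigma]
      · rintro (_ | u) <;> simp [Equiv.uniqueSigma]
    · refine ((((h hC (fun c => L (some c)) (fun _ => hL _)).union hnew).join
        (i := 0) (j := 2) (by norm_num) (by norm_num) (by norm_num)).relabel
        (i := 2) (j := 0) (by norm_num) (by norm_num)).of_equiv
        { toFun := Sum.elim (fun x => ⟨some x.1, x.2⟩) (fun x => ⟨none, x⟩)
          invFun := fun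
            | ⟨none, x⟩ => .inr x
            | ⟨some c, x⟩ => .inl ⟨c, x⟩
          left_inv := by rintro (⟨_, _⟩ | _) <;> rfl
          right_inv := by rintro ⟨_ | _, _⟩ <;> rfl } ?_ ?_
      · rintro (⟨c, _ | u⟩ | _ | u) (⟨d, _ | v⟩ | _ | v) <;> simp
      · rintro (⟨c, _ | u⟩ | _ | u) <;> simp

/-- The vertices of `S₂` grouped by the star they belong to. -/
def starEquiv {t : ℕ} (p q : Fin t → ℕ) :
    (Σ c : (Σ i, Fin (q i)), Option (Fin (p c.1))) ≃ S2Verts t p q where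
  toFun
    | ⟨c, none⟩ => .inl c
    | ⟨c, some x⟩ => .inr ⟨c.1, c.2, x⟩
  invFun
    | .inl c => ⟨c, none⟩
    | .inr e => ⟨⟨e.1, e.2.1⟩, some e.2.2⟩
  left_inv := by rintro ⟨_, _ | _⟩ <;> rfl
  right_inv := by rintro (_ | _) <;> rfl

theorem splitInverse_adj_inl_inl {α β : Type} (G : SimpleGraph (α ⊕ β)) (a b : α) :
    ¬ (splitInverse G (Set.range Sum.inl) (Set.range Sum.inr)).Adj (.inl a) (.inl b) := by
  simp [splitInverse]

theorem splitInverse_adj_inl_inr {α β : Type} (G : SimpleGraph (α ⊕ β)) (a : α) (b : β) :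
    (splitInverse G (Set.range Sum.inl) (Set.range Sum.inr)).Adj (.inl a) (.inr b) ↔
      G.Adj (.inl a) (.inr b) := by
  simp [splitInverse, G.adj_comm (.inr b)]

theorem splitInverse_adj_inr_inr {α β : Type} (G : SimpleGraph (α ⊕ β)) (a b : β) :
    (splitInverse G (Set.range Sum.inl) (Set.range Sum.inr)).Adj (.inr a) (.inr b) ↔
      a ≠ b := by
  simp [splitInverse]

theorem S2_adj_inl_inr {t : ℕ} (p q : Fin t → ℕ) (c : Σ i, Fin (q i))
    (e : Σ i, Fin (q i) × Fin (p i)) :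
    (S2 t p q).Adj (.inl c) (.inr e) ↔ leafCenter e = c :=
  ⟨fun h => h.2.elim id False.elim, fun h => ⟨Sum.inl_ne_inr, .inl h⟩⟩

theorem stmt14 (t : ℕ) (ht : 1 ≤ t) (p q : Fin t → ℕ)
    (hp : ∀ i, 1 ≤ p i) (hq : ∀ i, 1 ≤ q i) (hsum : 2 ≤ ∑ i, q i) :
    splitCliqueWidth (splitInverse (S2 t p q) (Set.range Sum.inl) (Set.range Sum.inr))
      (Set.range Sum.inr) (Set.range Sum.inl) ≤ 3 := by
  have : Nonempty (Σ i, Fin (q i)) := ⟨⟨⟨0, ht⟩, ⟨0, hq _⟩⟩⟩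
  obtain ⟨e, he, f, hadj, hlab⟩ :=
    buildable_invertedStars (Σ i, Fin (q i)) (fun c => Fin (p c.1))
  refine Nat.sInf_le ⟨e, he, f.trans (starEquiv p q), fun u v => ?_, fun u => ?_⟩
  · rw [← hadj]
    simp only [Equiv.trans_apply]
    generalize f u = x
    generalize f v = y
    obtain ⟨c, _ | x⟩ := x <;> obtain ⟨d, _ | y⟩ := y
    · exact iff_of_false (splitInverse_adj_inl_inl _ _ _) (by grind)
    · refine (splitInverse_adj_inl_inr _ _ _).trans ((S2_adj_inl_inr _ _ _ _).trans ?_)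
      simp [leafCenter]
      grind
    · refine (SimpleGraph.adj_comm _ _ _).trans ((splitInverse_adj_inl_inr _ _ _).trans
        ((S2_adj_inl_inr _ _ _ _).trans ?_))
      simp [leafCenter]
      grind
    · refine (splitInverse_adj_inr_inr _ _ _).trans ?_
      obtain ⟨i, a⟩ := c
      obtain ⟨j, b⟩ := d
      simp
      grind
  · rw [← hlab]
    simp only [Equiv.trans_apply]
    generalize f u = x
    obtain ⟨c, _ | x⟩ := x
    · exact ⟨fun h => (Sum.inr_ne_inl h.choose_spec).elim, fun _ => rfl⟩
    · exact ⟨fun _ => rfl, fun h => (Sum.inl_ne_inr h.choose_spec).elim⟩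


end CWPaper
end

section
/- For all parameters p_1, q_1, …, p_t, q_t ≥ 1 with t ≥ 1 and q_1 + ⋯ + q_t ≥ 2, the split clique-width of the complement of S_2(p_1, q_1; …; p_t, q_t), regarded as a splitted graph whose clique is the set of former leaves and whose independent set is the set of former centers, is at most 4. -/
namespace CWPaper

/-- Some valid `k`-expression builds, on the vertex set `S`, the graph whose adjacency is `R`
and whose labels are `l` (both only matter on `S`). -/
def Expr.Builds (k : ℕ) {V : Type*} (S : Set V) (l : V → ℕ) (R : V → V → Prop) : Prop :=
  ∃ (e : Expr) (f : e.Verts → V), e.Valid k ∧ Function.Injective f ∧ Set.range f = S ∧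
    (∀ u, e.label u = l (f u)) ∧ ∀ u v, e.adj u v ↔ R (f u) (f v)

namespace Expr.Builds

variable {k : ℕ} {V : Type*} {S T : Set V} {l l' : V → ℕ} {R R' : V → V → Prop}

theorem congr (h : Builds k S l R) (hl : ∀ u ∈ S, l u = l' u)
    (hR : ∀ u ∈ S, ∀ v ∈ S, R u v ↔ R' u v) : Builds k S l' R' := by
  obtain ⟨e, f, he, hf, rfl, hlab, hadj⟩ := h
  refine ⟨e, f, he, hf, rfl, fun u => ?_, fun u v => ?_⟩
  · rw [hlab, hl _ ⟨u, rfl⟩]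
  · rw [hadj, hR _ ⟨u, rfl⟩ _ ⟨v, rfl⟩]

theorem singleton (v : V) (hl : l v < k) (hR : ¬ R v v) : Builds k {v} l R := by
  refine ⟨.vert (l v), fun _ => v, hl, fun _ _ _ => rfl, ?_, fun _ => rfl, fun _ _ => ?_⟩
  · ext x
    exact ⟨fun ⟨_, h⟩ => h.symm, fun h => ⟨(), h.symm⟩⟩
  · simp [adj, hR]

theorem union (hS : Builds k S l R) (hT : Builds k T l R) (hST : Disjoint S T)
    (hR : ∀ u ∈ S, ∀ v ∈ T, ¬ R u v ∧ ¬ R v u) : Builds k (S ∪ T) l R := by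
  obtain ⟨e, f, he, hf, rfl, hlab, hadj⟩ := hS
  obtain ⟨e', f', he', hf', rfl, hlab', hadj'⟩ := hT
  refine ⟨.union e e', Sum.elim f f', ⟨he, he'⟩, ?_, Set.Sum.elim_range f f', ?_, ?_⟩
  · exact hf.sumElim hf' fun a b h => Set.disjoint_left.1 hST ⟨a, rfl⟩ ⟨b, h.symm⟩
  · rintro (u | u)
    · exact hlab u
    · exact hlab' u
  · rintro (u | u) (v | v)
    · exact hadj u v
    · exact iff_of_false id (hR _ ⟨u, rfl⟩ _ ⟨v, rfl⟩).1
    · exact iff_of_false id (hR _ ⟨v, rfl⟩ _ ⟨u, rfl⟩).2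
    · exact hadj' u v

theorem join (h : Builds k S l R) (i j : ℕ) (hi : i < k) (hj : j < k) (hij : i ≠ j) :
    Builds k S l fun u v => R u v ∨ (l u = i ∧ l v = j) ∨ (l u = j ∧ l v = i) := by
  obtain ⟨e, f, he, hf, rfl, hlab, hadj⟩ := h
  refine ⟨.join i j e, f, ⟨hi, hj, hij, he⟩, hf, rfl, hlab, fun u v => ?_⟩
  simp only [adj]
  rw [hadj u v, hlab u, hlab v]

theorem relabel (h : Builds k S l R) (i j : ℕ) (hi : i < k) (hj : j < k) :
    Builds k S (fun v => if l v = i then j else l v) R := by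
  obtain ⟨e, f, he, hf, rfl, hlab, hadj⟩ := h
  refine ⟨.relabel i j e, f, ⟨hi, hj, he⟩, hf, rfl, fun u => ?_, hadj⟩
  simp only [label]
  rw [hlab u]

theorem splitCliqueWidth_le {G : SimpleGraph V} {A B : Set V}
    (h : Builds k Set.univ l G.Adj) (hA : ∀ v ∈ A, l v = 0) (hB : ∀ v ∈ B, l v = 1) :
    splitCliqueWidth G A B ≤ k := by
  obtain ⟨e, f, he, hf, hr, hlab, hadj⟩ := h
  refine Nat.sInf_le ⟨e, he, Equiv.ofBijective f ⟨hf, Set.range_eq_univ.1 hr⟩,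
    fun u v => (hadj u v).symm, fun u => ⟨fun h => ?_, fun h => ?_⟩⟩
  · rw [hlab]
    exact hA _ h
  · rw [hlab]
    exact hB _ h

end Expr.Builds

/-- Adjacency in the complement of a clique of stars with centers `C` and leaves `L`, where
`own` sends each leaf to its center. -/
def costarAdj {C L : Type*} (own : L → C) : C ⊕ L → C ⊕ L → Prop
  | .inl _, .inl _ => False
  | .inl c, .inr x => own x ≠ c
  | .inr x, .inl c => own x ≠ c
  | .inr x, .inr y => x ≠ y

section Costar

variable {C L : Type*} (own : L → C)

open Classical in
theorem builds_costar_partial (c : C) (s : Finset L) (hs : ∀ x ∈ s, own x = c) :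
    Expr.Builds 4 ({Sum.inl c} ∪ Sum.inr '' (s : Set L)) (Sum.elim (fun _ => 3) fun _ => 2)
      (costarAdj own) := by
  induction s using Finset.induction_on with
  | empty =>
    simpa using Expr.Builds.singleton (Sum.inl c) (by simp) (by simp [costarAdj])
  | insert a s ha ih =>
    have hs' : ∀ x ∈ s, own x = c := fun x hx => hs x (Finset.mem_insert_of_mem hx)
    have hac : own a = c := hs a (Finset.mem_insert_self a s)
    let l : C ⊕ L → ℕ := Sum.elim (fun _ => 3) fun x => if x = a then 0 else 2
    let R : C ⊕ L → C ⊕ L → Prop := fun u v =>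
      costarAdj own u v ∧ (u = Sum.inr a ↔ v = Sum.inr a)
    have h1 : Expr.Builds 4 ({Sum.inl c} ∪ Sum.inr '' (s : Set L)) l R := by
      refine (ih hs').congr ?_ ?_
      · rintro (u | u) hu
        · rfl
        · grind
      · rintro (u | u) hu (v | v) hv <;> grind
    have h2 : Expr.Builds 4 {Sum.inr a} l R :=
      Expr.Builds.singleton _ (by simp [l]) (by simp [R, costarAdj])
    have h3 := h1.union h2 (by simp [ha]) (by
      rintro (u | u) hu _ rfl <;> grind)
    have h4 := (h3.join 0 2 (by simp) (by simp) (by simp)).relabel 0 2 (by simp) (by simp)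
    have hset : ({Sum.inl c} ∪ Sum.inr '' ((insert a s : Finset L) : Set L) : Set (C ⊕ L)) =
        {Sum.inl c} ∪ Sum.inr '' (s : Set L) ∪ {Sum.inr a} := by
      ext x
      simp only [Finset.coe_insert, Set.image_insert_eq]
      grind
    rw [hset]
    refine h4.congr ?_ ?_
    · rintro (u | u) hu <;> grind
    · rintro (u | u) hu (v | v) hv <;> grind [costarAdj]

theorem builds_costar_star [Finite L] (c : C) :
    Expr.Builds 4 {v | Sum.elim id own v = c} (Sum.elim (fun _ => 3) fun _ => 2)
      (costarAdj own) := by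
  classical
  have := Fintype.ofFinite L
  have h := builds_costar_partial own c {x | own x = c} (by simp)
  convert h using 1
  ext (x | x) <;> simp

open Classical in
theorem builds_costar_subset [Finite L] (s : Finset C) (hs : s.Nonempty) :
    Expr.Builds 4 {v | Sum.elim id own v ∈ s} (Sum.elim (fun _ => 1) fun _ => 0)
      (costarAdj own) := by
  induction hs using Finset.Nonempty.cons_induction with
  | singleton c =>
    have h := ((builds_costar_star own c).relabel 3 1 (by simp) (by simp)).relabel 2 0
      (by simp) (by simp)
    simp only [Finset.mem_singleton]
    refine h.congr ?_ fun _ _ _ _ => Iff.rfl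
    rintro (u | u) - <;> simp
  | cons c s hc hs ih =>
    let l : C ⊕ L → ℕ := Sum.elim (fun b => if b = c then 3 else 1)
      fun x => if own x = c then 2 else 0
    let R : C ⊕ L → C ⊕ L → Prop := fun u v =>
      costarAdj own u v ∧ (Sum.elim id own u = c ↔ Sum.elim id own v = c)
    have h1 : Expr.Builds 4 {v | Sum.elim id own v ∈ s} l R := by
      refine ih.congr ?_ ?_
      · rintro (u | u) hu <;> simp at hu <;> grind
      · rintro u hu v hv
        simp only [Set.mem_ofPred_eq] at hu hv
        grind
    have h2 : Expr.Builds 4 {v | Sum.elim id own v = c} l R := by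
      refine (builds_costar_star own c).congr ?_ ?_
      · rintro (u | u) hu <;> simp at hu <;> grind
      · rintro u hu v hv
        simp only [Set.mem_ofPred_eq] at hu hv
        grind
    have h3 := h1.union h2
      (Set.disjoint_left.2 fun x hx hx' => hc (by simp_all))
      (by
        intro u hu v hv
        simp only [Set.mem_ofPred_eq] at hu hv
        grind)
    have h4 := ((((h3.join 0 2 (by simp) (by simp) (by simp)).join 1 2 (by simp) (by simp)
      (by simp)).join 0 3 (by simp) (by simp) (by simp)).relabel 3 1 (by simp)
      (by simp)).relabel 2 0 (by simp) (by simp)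
    have hset : {v | Sum.elim id own v ∈ Finset.cons c s hc} =
        {v | Sum.elim id own v ∈ s} ∪ {v | Sum.elim id own v = c} := by
      ext x
      simp [or_comm]
    rw [hset]
    refine h4.congr ?_ ?_
    · rintro (u | u) hu <;> simp only [l, Sum.elim_inl, Sum.elim_inr] <;> grind
    · rintro (u | u) hu (v | v) hv <;> simp [l, R, costarAdj] <;> grind

theorem builds_costar [Finite C] [Finite L] [Nonempty C] :
    Expr.Builds 4 Set.univ (Sum.elim (fun _ => 1) fun _ => 0) (costarAdj own) := by
  have := Fintype.ofFinite C
  simpa using builds_costar_subset own Finset.univ Finset.univ_nonempty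

end Costar

theorem compl_S2_adj {t : ℕ} {p q : Fin t → ℕ} (x y : S2Verts t p q) :
    (S2 t p q)ᶜ.Adj x y ↔ costarAdj leafCenter x y := by
  rw [SimpleGraph.compl_adj, S2, SimpleGraph.fromRel_adj]
  rcases x with x | x <;> rcases y with y | y <;> simp [costarAdj]
  · exact ⟨fun h => h.2 Sum.inl_ne_inr, fun h => ⟨Sum.inl_ne_inr, fun _ => h⟩⟩
  · exact ⟨fun h => h.2 Sum.inr_ne_inl, fun h => ⟨Sum.inr_ne_inl, fun _ => h⟩⟩
  · exact Sum.inr_injective.ne_iff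

theorem stmt15 (t : ℕ) (ht : 1 ≤ t) (p q : Fin t → ℕ)
    (hp : ∀ i, 1 ≤ p i) (hq : ∀ i, 1 ≤ q i) (hsum : 2 ≤ ∑ i, q i) :
    splitCliqueWidth (S2 t p q)ᶜ (Set.range Sum.inr) (Set.range Sum.inl) ≤ 4 := by
  have : Nonempty (Σ i : Fin t, Fin (q i)) := ⟨⟨⟨0, ht⟩, ⟨0, hq _⟩⟩⟩
  refine Expr.Builds.splitCliqueWidth_le (l := Sum.elim (fun _ => 1) fun _ => 0)
    ((builds_costar (leafCenter (p := p) (q := q))).congr (fun _ _ => rfl)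
      fun u _ v _ => (compl_S2_adj u v).symm) ?_ ?_
  · rintro _ ⟨x, rfl⟩
    rfl
  · rintro _ ⟨x, rfl⟩
    rfl

end CWPaper
end
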